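/- (Sufficient decrease of the Lyapunov function.) Under the stated assumptions, if β > max{β′, β″}, then there exist δ₁,…,δ₄ ∈ (0,1) with δᵢ Mᵢ ⪰ Nᵢ such that for every k, Ψ^k − Ψ^{k+1} ≥ Σᵢ₌₁⁴ (1−δᵢ)‖Δxᵢ^k‖²_{Mᵢ}, and the right-hand side is nonnegative; in particular the sequence {Ψ^k} is nonincreasing. -/

import Mathlib

open scoped RealInnerProductSpace
open Matrix

noncomputable section

/-- `ℝ^{4n}`, regarded as `n` blocks of `ℝ⁴`. -/
abbrev E4 (n : ℕ) := EuclideanSpace ℝ (Fin n × Fin 4)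

/-- `ℝ^{3n}`, regarded as `n` blocks of `ℝ³`. -/
abbrev E3 (n : ℕ) := EuclideanSpace ℝ (Fin n × Fin 3)

/-- The product of `n` unit spheres in `ℝ⁴`: each 4-coordinate block has norm 1. -/
def Msph (n : ℕ) : Set (E4 n) := {x | ∀ i : Fin n, ∑ j : Fin 4, x (i, j) ^ 2 = 1}

/-- Partial gradient of `f` w.r.t. its first block. -/
def grad1f {n : ℕ} (f : E4 n → E4 n → E3 n → E3 n → ℝ) (a b : E4 n) (c d : E3 n) : E4 n :=
  gradient (fun y => f y b c d) a

/-- Partial gradient of `f` w.r.t. its second block. -/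
def grad2f {n : ℕ} (f : E4 n → E4 n → E3 n → E3 n → ℝ) (a b : E4 n) (c d : E3 n) : E4 n :=
  gradient (fun y => f a y c d) b

/-- Partial gradient of `f` w.r.t. its third block. -/
def grad3f {n : ℕ} (f : E4 n → E4 n → E3 n → E3 n → ℝ) (a b : E4 n) (c d : E3 n) : E3 n :=
  gradient (fun y => f a b y d) c

/-- Partial gradient of `f` w.r.t. its fourth block. -/
def grad4f {n : ℕ} (f : E4 n → E4 n → E3 n → E3 n → ℝ) (a b : E4 n) (c d : E3 n) : E3 n :=
  gradient (fun y => f a b c y) d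

/-- Partial gradient of `g` w.r.t. its first block. -/
def grad1g {n : ℕ} (g : E4 n → E4 n → ℝ) (a b : E4 n) : E4 n :=
  gradient (fun y => g y b) a

/-- Partial gradient of `g` w.r.t. its second block. -/
def grad2g {n : ℕ} (g : E4 n → E4 n → ℝ) (a b : E4 n) : E4 n :=
  gradient (fun y => g a y) b

/-- The quadratic form `‖v‖²_H = ⟨v, Hv⟩` of a matrix `H`. -/
def qf {ι : Type*} [Fintype ι] [DecidableEq ι] (H : Matrix ι ι ℝ)
    (v : EuclideanSpace ℝ ι) : ℝ :=
  ⟪v, Matrix.toEuclideanLin H v⟫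

/-- The augmented Lagrangian
`L_β(x,λ) = f + g − ⟨λ₁, x₁−x₂⟩ − ⟨λ₂, x₃−x₄⟩ + (β/2)(‖x₁−x₂‖² + ‖x₃−x₄‖²)`. -/
def augL {n : ℕ} (f : E4 n → E4 n → E3 n → E3 n → ℝ) (g : E4 n → E4 n → ℝ) (β : ℝ)
    (x1 x2 : E4 n) (x3 x4 : E3 n) (l1 : E4 n) (l2 : E3 n) : ℝ :=
  f x1 x2 x3 x4 + g x1 x2 - ⟪l1, x1 - x2⟫ - ⟪l2, x3 - x4⟫ +
    β / 2 * (‖x1 - x2‖ ^ 2 + ‖x3 - x4‖ ^ 2)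


section QuadraticForm

variable {ι : Type*} [Fintype ι] [DecidableEq ι]

lemma qf_sub (A B : Matrix ι ι ℝ) (v : EuclideanSpace ℝ ι) :
    qf (A - B) v = qf A v - qf B v := by
  simp [qf, inner_sub_right]

lemma qf_add (A B : Matrix ι ι ℝ) (v : EuclideanSpace ℝ ι) :
    qf (A + B) v = qf A v + qf B v := by
  simp [qf, inner_add_right]

lemma qf_smul (c : ℝ) (A : Matrix ι ι ℝ) (v : EuclideanSpace ℝ ι) :
    qf (c • A) v = c * qf A v := by
  simp [qf, inner_smul_right]

lemma qf_one (v : EuclideanSpace ℝ ι) : qf (1 : Matrix ι ι ℝ) v = ‖v‖ ^ 2 := by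
  simp [qf]

lemma qf_transpose_mul_self (A : Matrix ι ι ℝ) (v : EuclideanSpace ℝ ι) :
    qf (Aᵀ * A) v = ‖Matrix.toEuclideanLin A v‖ ^ 2 := by
  have h : Matrix.toEuclideanLin (Aᵀ * A) v =
      Matrix.toEuclideanLin A.conjTranspose (Matrix.toEuclideanLin A v) := by
    simp [Matrix.toLpLin_apply, Matrix.conjTranspose_eq_transpose_of_trivial]
  rw [qf, h, Matrix.toEuclideanLin_conjTranspose_eq_adjoint, LinearMap.adjoint_inner_right,
    real_inner_self_eq_norm_sq]

lemma qf_smul_right (A : Matrix ι ι ℝ) (c : ℝ) (v : EuclideanSpace ℝ ι) :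
    qf A (c • v) = c ^ 2 * qf A v := by
  simp only [qf, map_smul, inner_smul_left, inner_smul_right, conj_trivial]
  ring

lemma posSemidef_iff_qf_nonneg {A : Matrix ι ι ℝ} (hA : A.IsHermitian) :
    A.PosSemidef ↔ ∀ v, 0 ≤ qf A v := by
  rw [← Matrix.isPositive_toEuclideanLin_iff]
  constructor
  · intro h v
    exact h.inner_nonneg_right v
  · intro h
    refine ⟨Matrix.isSymmetric_toEuclideanLin_iff.2 hA, fun v => ?_⟩
    simpa [qf, real_inner_comm] using h v

/-- If every eigenvalue of a symmetric matrix is at least `c`, then `c` bounds its Rayleigh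
quotient from below. -/
lemma le_qf_of_forall_eigenvalue_ge {A : Matrix ι ι ℝ} (hA : A.IsHermitian) {c : ℝ}
    (h : ∀ (μ : ℝ) (v : ι → ℝ), v ≠ 0 → A *ᵥ v = μ • v → c ≤ μ) (v : EuclideanSpace ℝ ι) :
    c * ‖v‖ ^ 2 ≤ qf A v := by
  have hB : (A - c • (1 : Matrix ι ι ℝ)).IsHermitian :=
    hA.sub (by simp [Matrix.IsHermitian])
  have hpos : (A - c • (1 : Matrix ι ι ℝ)).PosSemidef := by
    rw [hB.posSemidef_iff_eigenvalues_nonneg]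
    intro i
    have hev := hB.mulVec_eigenvectorBasis i
    rw [Matrix.sub_mulVec, Matrix.smul_mulVec, Matrix.one_mulVec, sub_eq_iff_eq_add,
      ← add_smul] at hev
    have hne : (WithLp.ofLp (hB.eigenvectorBasis i)) ≠ 0 := by
      intro h0
      exact hB.eigenvectorBasis.toBasis.ne_zero i (by simpa using h0)
    have := h _ _ hne hev
    simpa using this
  have := (posSemidef_iff_qf_nonneg hB).1 hpos v
  rw [qf_sub, qf_smul, qf_one] at this
  linarith

lemma eigenvalue_pos {ι : Type*} [Fintype ι] {A : Matrix ι ι ℝ} (hA : A.PosDef) {μ : ℝ} {v : ι → ℝ} (hv : v ≠ 0)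
    (h : A *ᵥ v = μ • v) : 0 < μ := by
  have h1 := hA.dotProduct_mulVec_pos hv
  rw [h, dotProduct_smul, smul_eq_mul] at h1
  have h2 : 0 ≤ star v ⬝ᵥ v := dotProduct_star_self_nonneg v
  exact pos_of_mul_pos_left h1 h2

lemma norm_toEuclideanLin_sq_le {A : Matrix ι ι ℝ} (hA : A.PosDef) {c : ℝ}
    (h : ∀ (μ : ℝ) (v : ι → ℝ), v ≠ 0 → A *ᵥ v = μ • v → μ ≤ c) (v : EuclideanSpace ℝ ι) :
    ‖Matrix.toEuclideanLin A v‖ ^ 2 ≤ c ^ 2 * ‖v‖ ^ 2 := by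
  have hT : Aᵀ = A := by simpa [Matrix.IsHermitian] using hA.isHermitian
  have hherm : (-(Aᵀ * A)).IsHermitian := by
    simp [Matrix.IsHermitian, Matrix.conjTranspose_eq_transpose_of_trivial]
  have key := le_qf_of_forall_eigenvalue_ge hherm (c := -c ^ 2) ?_ v
  · have : qf (-(Aᵀ * A)) v = - qf (Aᵀ * A) v := by simp [qf]
    rw [this, qf_transpose_mul_self] at key
    linarith
  intro μ w hw hμ
  have hsq : A *ᵥ (A *ᵥ w) = (-μ) • w := by
    rw [Matrix.neg_mulVec, hT, ← Matrix.mulVec_mulVec] at hμ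
    rw [neg_smul, ← hμ, neg_neg]
  by_contra! hlt
  have hμ0 : 0 < -μ := by nlinarith [sq_nonneg c]
  have hs : 0 < √(-μ) := Real.sqrt_pos.2 hμ0
  have hss : √(-μ) * √(-μ) = -μ := Real.mul_self_sqrt hμ0.le
  by_cases hu : A *ᵥ w + √(-μ) • w = 0
  · have := eigenvalue_pos hA hw (μ := -√(-μ)) (by rw [neg_smul]; exact eq_neg_of_add_eq_zero_left hu)
    linarith
  · have h1 : √(-μ) ≤ c := h _ _ hu (by
      rw [Matrix.mulVec_add, Matrix.mulVec_smul, hsq, smul_add, smul_smul, hss, add_comm])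
    nlinarith

/-- A symmetric matrix pencil `M - N` bounded below by `ε` stays nonnegative after shrinking `M`
slightly. -/
lemma exists_shrink {M N : Matrix ι ι ℝ} (hM : M.IsHermitian) (hN : N.IsHermitian)
    (hN0 : ∀ v, 0 ≤ qf N v) {ε : ℝ} (hε : 0 < ε) (h : ∀ v, ε * ‖v‖ ^ 2 ≤ qf M v - qf N v) :
    ∃ δ ∈ Set.Ioo (0 : ℝ) 1, (δ • M - N).PosSemidef ∧ (∀ v, qf N v ≤ δ * qf M v) ∧
      ∀ v, 0 ≤ (1 - δ) * qf M v := by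
  obtain ⟨C, hC0, hC⟩ : ∃ C : ℝ, 0 ≤ C ∧ ∀ v, qf M v ≤ C * ‖v‖ ^ 2 := by
    refine ⟨‖(Matrix.toEuclideanLin M).toContinuousLinearMap‖, norm_nonneg _, fun v => ?_⟩
    calc qf M v ≤ ‖v‖ * ‖Matrix.toEuclideanLin M v‖ := real_inner_le_norm _ _
      _ ≤ ‖v‖ * (‖(Matrix.toEuclideanLin M).toContinuousLinearMap‖ * ‖v‖) := by
        gcongr
        exact (Matrix.toEuclideanLin M).toContinuousLinearMap.le_opNorm v
      _ = _ := by ring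
  have ht0 : 0 < min (1 / 2) (ε / (C + 1)) := by positivity
  have ht1 : min (1 / 2) (ε / (C + 1)) ≤ 1 / 2 := min_le_left _ _
  have htC : min (1 / 2) (ε / (C + 1)) * C ≤ ε := by
    have h1 : min (1 / 2) (ε / (C + 1)) ≤ ε / (C + 1) := min_le_right _ _
    rw [le_div_iff₀ (by positivity)] at h1
    nlinarith
  set t := min (1 / 2) (ε / (C + 1))
  have hle : ∀ v, qf N v ≤ (1 - t) * qf M v := fun v => by
    have h1 := mul_le_mul_of_nonneg_left (hC v) ht0.le
    have h2 := mul_le_mul_of_nonneg_right htC (sq_nonneg ‖v‖)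
    nlinarith [h v]
  refine ⟨1 - t, ⟨by linarith, by linarith⟩, ?_, hle, fun v => ?_⟩
  · rw [posSemidef_iff_qf_nonneg ((hM.smul (IsSelfAdjoint.all (1 - t))).sub hN)]
    intro v
    rw [qf_sub, qf_smul]
    linarith [hle v]
  · have hM0 : 0 ≤ qf M v := by nlinarith [h v, hN0 v, mul_nonneg hε.le (sq_nonneg ‖v‖)]
    rw [sub_sub_cancel]
    positivity

end QuadraticForm

section Proximal

variable {E : Type*} [NormedAddCommGroup E] [InnerProductSpace ℝ E]

lemma norm_sub_sq_convexComb_le (a p z : E) {t : ℝ} (h0 : 0 ≤ t) (h1 : t ≤ 1) :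
    ‖a - ((1 - t) • p + t • z)‖ ^ 2 ≤ (1 - t) * ‖a - p‖ ^ 2 + t * ‖a - z‖ ^ 2 := by
  have h := (convexOn_univ_norm (E := E)).pow (fun _ _ => norm_nonneg _) 2
  have := h.2 (Set.mem_univ (a - p)) (Set.mem_univ (a - z)) (sub_nonneg.2 h1) h0 (by ring)
  have e : a - ((1 - t) • p + t • z) = (1 - t) • (a - p) + t • (a - z) := by module
  rw [e]
  simpa using this

lemma norm_sq_relaxation_le {τ : ℝ} (hτ : 0 < τ) (hs : |1 - τ| < 1) (u w : E) :
    ‖(1 - τ) • u + τ • w‖ ^ 2 ≤ |1 - τ| * ‖u‖ ^ 2 + τ ^ 2 / (1 - |1 - τ|) * ‖w‖ ^ 2 := by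
  have h1 : ‖(1 - τ) • u + τ • w‖ ≤ |1 - τ| * ‖u‖ + τ * ‖w‖ := by
    refine (norm_add_le _ _).trans_eq ?_
    rw [norm_smul, norm_smul, Real.norm_eq_abs, Real.norm_eq_abs, abs_of_pos hτ]
  have h0 := abs_nonneg (1 - τ)
  set s := |1 - τ|
  have hs' : 0 < 1 - s := by linarith
  refine (pow_le_pow_left₀ (norm_nonneg _) h1 2).trans ?_
  rw [← sub_nonneg]
  have : s * ‖u‖ ^ 2 + τ ^ 2 / (1 - s) * ‖w‖ ^ 2 - (s * ‖u‖ + τ * ‖w‖) ^ 2 =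
      s * ((1 - s) * ‖u‖ - τ * ‖w‖) ^ 2 / (1 - s) := by
    field_simp
    ring
  rw [this]
  positivity

/-- The multiplier increment, controlled by the residual of the dual update. -/
lemma multiplier_increment_le {τ β : ℝ} (hτ : τ ∈ Set.Ioo (0 : ℝ) 2) (hβ : 0 < β)
    {l₀ l₁ l₂ r₁ r₂ : E} (h₁ : l₁ = l₀ - (τ * β) • r₁) (h₂ : l₂ = l₁ - (τ * β) • r₂) :
    1 / (τ * β) * ‖l₂ - l₁‖ ^ 2 ≤
      |1 - τ| / (1 - |1 - τ|) / (τ * β) * (‖l₁ - l₀‖ ^ 2 - ‖l₂ - l₁‖ ^ 2) +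
        τ / (1 - |1 - τ|) ^ 2 / β * ‖(l₁ - β • r₂) - (l₀ - β • r₁)‖ ^ 2 := by
  have hτ0 := hτ.1
  have hs : |1 - τ| < 1 := abs_lt.2 ⟨by linarith [hτ.2], by linarith⟩
  have key := norm_sq_relaxation_le hτ0 hs (l₁ - l₀) ((l₁ - β • r₂) - (l₀ - β • r₁))
  have e : (1 - τ) • (l₁ - l₀) + τ • ((l₁ - β • r₂) - (l₀ - β • r₁)) = l₂ - l₁ := by
    subst h₁ h₂
    module
  rw [e] at key
  generalize ‖l₂ - l₁‖ ^ 2 = A at *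
  generalize ‖l₁ - l₀‖ ^ 2 = B at *
  generalize ‖(l₁ - β • r₂) - (l₀ - β • r₁)‖ ^ 2 = C at *
  have hs' : 0 < 1 - |1 - τ| := by linarith
  generalize |1 - τ| = s at *
  rw [← sub_nonneg] at key ⊢
  have : s / (1 - s) / (τ * β) * (B - A) + τ / (1 - s) ^ 2 / β * C - 1 / (τ * β) * A =
      (s * B + τ ^ 2 / (1 - s) * C - A) / ((1 - s) * (τ * β)) := by
    field_simp
    ring
  rw [this]
  positivity

lemma norm_add_three_sq_le {E : Type*} [SeminormedAddCommGroup E] (a b c : E) :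
    ‖a + b + c‖ ^ 2 ≤ 3 * (‖a‖ ^ 2 + ‖b‖ ^ 2 + ‖c‖ ^ 2) := by
  have h := pow_le_pow_left₀ (norm_nonneg _) (norm_add₃_le (a := a) (b := b) (c := c)) 2
  nlinarith [sq_nonneg (‖a‖ - ‖b‖), sq_nonneg (‖a‖ - ‖c‖), sq_nonneg (‖b‖ - ‖c‖)]

lemma norm_add_four_sq_le {E : Type*} [SeminormedAddCommGroup E] (a b c d : E) :
    ‖a + b + c + d‖ ^ 2 ≤ 4 * (‖a‖ ^ 2 + ‖b‖ ^ 2 + ‖c‖ ^ 2 + ‖d‖ ^ 2) := by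
  have h := pow_le_pow_left₀ (norm_nonneg _) (norm_add₄_le (a := a) (b := b) (c := c) (d := d)) 2
  nlinarith [sq_nonneg (‖a‖ - ‖b‖), sq_nonneg (‖a‖ - ‖c‖), sq_nonneg (‖b‖ - ‖c‖),
    sq_nonneg (‖a‖ - ‖d‖), sq_nonneg (‖b‖ - ‖d‖), sq_nonneg (‖c‖ - ‖d‖)]

/-- The dual step raises the augmented Lagrangian by a multiple of the squared increment. -/
lemma inner_dual_step {c : ℝ} (hc : c ≠ 0) {l l' r : E} (h : l' = l - c • r) :
    ⟪l, r⟫ - ⟪l', r⟫ = 1 / c * ‖l' - l‖ ^ 2 := by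
  subst h
  rw [← inner_sub_left, sub_sub_cancel, sub_sub_cancel_left, norm_neg, norm_smul, mul_pow,
    real_inner_smul_left, real_inner_self_eq_norm_sq, Real.norm_eq_abs, sq_abs]
  field_simp

variable {ι : Type*} [Fintype ι] [DecidableEq ι]

/-- A proximal step on a convex augmented Lagrangian block decreases it by the full squared
proximal norm. -/
lemma proximal_descent {F : EuclideanSpace ℝ ι → ℝ} (hF : ConvexOn ℝ Set.univ F) {β : ℝ}
    (hβ : 0 ≤ β) (H : Matrix ι ι ℝ) (l a p z : EuclideanSpace ℝ ι)
    (hmin : ∀ y, F p - ⟪l, a - p⟫ + β / 2 * ‖a - p‖ ^ 2 + 1 / 2 * qf H (p - z) ≤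
      F y - ⟪l, a - y⟫ + β / 2 * ‖a - y‖ ^ 2 + 1 / 2 * qf H (y - z)) :
    F p - ⟪l, a - p⟫ + β / 2 * ‖a - p‖ ^ 2 + qf H (p - z) ≤
      F z - ⟪l, a - z⟫ + β / 2 * ‖a - z‖ ^ 2 := by
  set Φ : EuclideanSpace ℝ ι → ℝ := fun y => F y - ⟪l, a - y⟫ + β / 2 * ‖a - y‖ ^ 2 with hΦ
  have key : ∀ t ∈ Set.Ioc (0 : ℝ) 1, Φ p + (1 - t / 2) * qf H (p - z) ≤ Φ z := by
    rintro t ⟨ht0, ht1⟩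
    have h1 := hmin ((1 - t) • p + t • z)
    have h2 := hF.2 (Set.mem_univ p) (Set.mem_univ z) (sub_nonneg.2 ht1) ht0.le (by ring)
    have h3 := mul_le_mul_of_nonneg_left (norm_sub_sq_convexComb_le a p z ht0.le ht1)
      (by positivity : 0 ≤ β / 2)
    have h4 : ⟪l, a - ((1 - t) • p + t • z)⟫ = (1 - t) * ⟪l, a - p⟫ + t * ⟪l, a - z⟫ := by
      rw [← real_inner_smul_right, ← real_inner_smul_right, ← inner_add_right]
      congr 1
      module
    have h5 : (1 - t) • p + t • z - z = (1 - t) • (p - z) := by module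
    rw [h5, qf_smul_right, h4] at h1
    simp only [smul_eq_mul] at h2
    have : 0 ≤ t * (Φ z - Φ p - (1 - t / 2) * qf H (p - z)) := by
      simp only [hΦ]
      nlinarith
    linarith [nonneg_of_mul_nonneg_right this ht0]
  have hlim : Filter.Tendsto (fun t : ℝ => Φ p + (1 - t / 2) * qf H (p - z))
      (nhdsWithin 0 (Set.Ioi 0)) (nhds (Φ p + (1 - 0 / 2) * qf H (p - z))) :=
    (Continuous.tendsto (by fun_prop) 0).mono_left nhdsWithin_le_nhds
  have := le_of_tendsto hlim
    (Filter.eventually_of_mem (Ioc_mem_nhdsGT one_pos) key)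
  simpa using this

/-- First-order optimality of a proximal step on an augmented Lagrangian block. -/
lemma proximal_optimality {F : EuclideanSpace ℝ ι → ℝ} {G p : EuclideanSpace ℝ ι}
    (hF : HasGradientAt F G p) (β : ℝ) {H : Matrix ι ι ℝ} (hH : H.IsHermitian)
    (l a z : EuclideanSpace ℝ ι)
    (hmin : ∀ y, F p - ⟪l, a - p⟫ + β / 2 * ‖a - p‖ ^ 2 + 1 / 2 * qf H (p - z) ≤
      F y - ⟪l, a - y⟫ + β / 2 * ‖a - y‖ ^ 2 + 1 / 2 * qf H (y - z)) :
    l - β • (a - p) = -(G + Matrix.toEuclideanLin H (p - z)) := by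
  set T := (Matrix.toEuclideanLin H).toContinuousLinearMap
  have hsub : HasFDerivAt (fun y => a - y) (-ContinuousLinearMap.id ℝ _) p :=
    (hasFDerivAt_id p).const_sub a
  have hsub' : HasFDerivAt (fun y => y - z) (ContinuousLinearMap.id ℝ _) p :=
    (hasFDerivAt_id p).sub_const z
  have hd := ((hF.hasFDerivAt.sub ((hasFDerivAt_const l p).inner ℝ hsub)).add
    (hsub.norm_sq.const_mul (β / 2))).add
      ((hsub'.inner ℝ (T.hasFDerivAt.comp p hsub')).const_mul (1 / 2))
  have hz := IsLocalMin.hasFDerivAt_eq_zero (Filter.Eventually.of_forall hmin) hd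
  have hsymm : ∀ u v : EuclideanSpace ℝ ι, ⟪u, T v⟫ = ⟪T u, v⟫ := fun u v =>
    ((Matrix.isSymmetric_toEuclideanLin_iff.2 hH) u v).symm
  refine ext_inner_right ℝ fun v => ?_
  have hv := DFunLike.congr_fun hz v
  have hs := hsymm (p - z) v
  have hs' := real_inner_comm v (T (p - z))
  have hT : ∀ u, Matrix.toEuclideanLin H u = T u := fun _ => rfl
  simp only [hT]
  simp [inner_sub_left, inner_add_left, inner_neg_left, real_inner_smul_left] at hv hs hs' ⊢
  linear_combination hv - 1 / 2 * hs + 1 / 2 * hs'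

end Proximal

lemma le_sq_mul_of_sqrt_le {A B L : ℝ} (hA : 0 ≤ A) (hB : 0 ≤ B) (h : √A ≤ L * √B) :
    A ≤ L ^ 2 * B := by
  have := pow_le_pow_left₀ (Real.sqrt_nonneg A) h 2
  rwa [mul_pow, Real.sq_sqrt hA, Real.sq_sqrt hB] at this

/-- The augmented Lagrangian proximal sweep decreases `augL` at fixed multipliers. -/
lemma augL_sweep_descent {n : ℕ} {f : E4 n → E4 n → E3 n → E3 n → ℝ} {g : E4 n → E4 n → ℝ}
    (hfconv2 : ∀ (a : E4 n) (c d : E3 n), ConvexOn ℝ Set.univ fun y => f a y c d)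
    (hfconv3 : ∀ (a b : E4 n) (d : E3 n), ConvexOn ℝ Set.univ fun y => f a b y d)
    (hfconv4 : ∀ (a b : E4 n) (c : E3 n), ConvexOn ℝ Set.univ fun y => f a b c y)
    (hgconv2 : ∀ a : E4 n, ConvexOn ℝ Set.univ fun y => g a y)
    {β : ℝ} (hβ : 0 < β)
    {H1 H2 : Matrix (Fin n × Fin 4) (Fin n × Fin 4) ℝ}
    {H3 H4 : Matrix (Fin n × Fin 3) (Fin n × Fin 3) ℝ}
    {a a' b b' : E4 n} {c c' d d' : E3 n} {l : E4 n} {m : E3 n}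
    (hmin1 : augL f g β a' b c d l m + 1 / 2 * qf H1 (a' - a) ≤ augL f g β a b c d l m)
    (hmin2 : ∀ y, augL f g β a' b' c d l m + 1 / 2 * qf H2 (b' - b) ≤
      augL f g β a' y c d l m + 1 / 2 * qf H2 (y - b))
    (hmin3 : ∀ y, augL f g β a' b' c' d l m + 1 / 2 * qf H3 (c' - c) ≤
      augL f g β a' b' y d l m + 1 / 2 * qf H3 (y - c))
    (hmin4 : ∀ y, augL f g β a' b' c' d' l m + 1 / 2 * qf H4 (d' - d) ≤
      augL f g β a' b' c' y l m + 1 / 2 * qf H4 (y - d)) :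
    augL f g β a' b' c' d' l m + (1 / 2 * qf H1 (a' - a) + qf H2 (b' - b) + qf H3 (c' - c) +
      qf H4 (d' - d)) ≤ augL f g β a b c d l m := by
  simp only [augL] at *
  have h2 := proximal_descent ((hfconv2 a' c d).add (hgconv2 a')) hβ.le H2 l a' b' b (fun y => by
    simp only [Pi.add_apply]
    linarith [hmin2 y])
  have h3 := proximal_descent (hfconv3 a' b' d) hβ.le H3 (-m) d c' c (fun y => by
    rw [inner_neg_left, inner_neg_left, ← inner_neg_right, ← inner_neg_right, neg_sub, neg_sub,
      norm_sub_rev d, norm_sub_rev d]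
    linarith [hmin3 y])
  have h4 := proximal_descent (hfconv4 a' b' c') hβ.le H4 m c' d' d (fun y => by
    linarith [hmin4 y])
  rw [inner_neg_left, inner_neg_left, ← inner_neg_right, ← inner_neg_right, neg_sub, neg_sub,
      norm_sub_rev d, norm_sub_rev d] at h3
  simp only [Pi.add_apply] at h2
  linarith

lemma augL_dual_step {n : ℕ} (f : E4 n → E4 n → E3 n → E3 n → ℝ) (g : E4 n → E4 n → ℝ)
    (β : ℝ) {c : ℝ} (hc : c ≠ 0) (a b : E4 n) (u v : E3 n) {l l' : E4 n} {m m' : E3 n}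
    (h1 : l' = l - c • (a - b)) (h2 : m' = m - c • (u - v)) :
    augL f g β a b u v l' m' =
      augL f g β a b u v l m + 1 / c * (‖l' - l‖ ^ 2 + ‖m' - m‖ ^ 2) := by
  have e1 := inner_dual_step hc h1
  have e2 := inner_dual_step hc h2
  simp only [augL]
  linarith

lemma residual_increment_sq_le {n : ℕ} {f : E4 n → E4 n → E3 n → E3 n → ℝ}
    {g : E4 n → E4 n → ℝ} {Lf Lg : ℝ}
    (hfLip : ∀ a b : E4 n, ∀ c d : E3 n, ∀ a' b' : E4 n, ∀ c' d' : E3 n,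
        Real.sqrt (‖grad1f f a b c d - grad1f f a' b' c' d'‖ ^ 2 +
            ‖grad2f f a b c d - grad2f f a' b' c' d'‖ ^ 2 +
            ‖grad3f f a b c d - grad3f f a' b' c' d'‖ ^ 2 +
            ‖grad4f f a b c d - grad4f f a' b' c' d'‖ ^ 2) ≤
          Lf * Real.sqrt (‖a - a'‖ ^ 2 + ‖b - b'‖ ^ 2 + ‖c - c'‖ ^ 2 + ‖d - d'‖ ^ 2))
    (hgLip : ∀ a b a' b' : E4 n,
        Real.sqrt (‖grad1g g a b - grad1g g a' b'‖ ^ 2 +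
            ‖grad2g g a b - grad2g g a' b'‖ ^ 2) ≤
          Lg * Real.sqrt (‖a - a'‖ ^ 2 + ‖b - b'‖ ^ 2))
    (a b a' b' h h' : E4 n) (c d c' d' : E3 n) :
    ‖-(grad2f f a b c d + grad2g g a b + h) - -(grad2f f a' b' c' d' + grad2g g a' b' + h')‖ ^ 2 ≤
      4 * (Lf ^ 2 * (‖a - a'‖ ^ 2 + ‖b - b'‖ ^ 2 + ‖c - c'‖ ^ 2 + ‖d - d'‖ ^ 2) +
        Lg ^ 2 * (‖a - a'‖ ^ 2 + ‖b - b'‖ ^ 2) + ‖h‖ ^ 2 + ‖h'‖ ^ 2) := by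
  have e : ∀ p q p' q' : E4 n, -(p + q + h) - -(p' + q' + h') =
      -(p - p') + -(q - q') + -h + h' := fun _ _ _ _ => by abel
  rw [e]
  refine (norm_add_four_sq_le _ _ _ _).trans ?_
  simp only [norm_neg]
  have hf := le_sq_mul_of_sqrt_le (by positivity) (by positivity) (hfLip a b c d a' b' c' d')
  have hg := le_sq_mul_of_sqrt_le (by positivity) (by positivity) (hgLip a b a' b')
  have := sq_nonneg ‖grad1f f a b c d - grad1f f a' b' c' d'‖
  have := sq_nonneg ‖grad3f f a b c d - grad3f f a' b' c' d'‖
  have := sq_nonneg ‖grad4f f a b c d - grad4f f a' b' c' d'‖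
  have := sq_nonneg ‖grad1g g a b - grad1g g a' b'‖
  linarith

lemma residual_increment_sq_le' {n : ℕ} {f : E4 n → E4 n → E3 n → E3 n → ℝ} {Lf : ℝ}
    (hfLip : ∀ a b : E4 n, ∀ c d : E3 n, ∀ a' b' : E4 n, ∀ c' d' : E3 n,
        Real.sqrt (‖grad1f f a b c d - grad1f f a' b' c' d'‖ ^ 2 +
            ‖grad2f f a b c d - grad2f f a' b' c' d'‖ ^ 2 +
            ‖grad3f f a b c d - grad3f f a' b' c' d'‖ ^ 2 +
            ‖grad4f f a b c d - grad4f f a' b' c' d'‖ ^ 2) ≤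
          Lf * Real.sqrt (‖a - a'‖ ^ 2 + ‖b - b'‖ ^ 2 + ‖c - c'‖ ^ 2 + ‖d - d'‖ ^ 2))
    (a b a' b' : E4 n) (c d c' d' h h' : E3 n) :
    ‖-(grad4f f a b c d + h) - -(grad4f f a' b' c' d' + h')‖ ^ 2 ≤
      3 * (Lf ^ 2 * (‖a - a'‖ ^ 2 + ‖b - b'‖ ^ 2 + ‖c - c'‖ ^ 2 + ‖d - d'‖ ^ 2) +
        ‖h‖ ^ 2 + ‖h'‖ ^ 2) := by
  have e : ∀ p p' : E3 n, -(p + h) - -(p' + h') = -(p - p') + -h + h' := fun _ _ => by abel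
  rw [e]
  refine (norm_add_three_sq_le _ _ _).trans ?_
  simp only [norm_neg]
  have hf := le_sq_mul_of_sqrt_le (by positivity) (by positivity) (hfLip a b c d a' b' c' d')
  have := sq_nonneg ‖grad1f f a b c d - grad1f f a' b' c' d'‖
  have := sq_nonneg ‖grad2f f a b c d - grad2f f a' b' c' d'‖
  have := sq_nonneg ‖grad3f f a b c d - grad3f f a' b' c' d'‖
  linarith

lemma isHermitian_smul_add_smul_transpose_mul {ι : Type*} [Fintype ι] [DecidableEq ι]
    (c p q : ℝ) (H : Matrix ι ι ℝ) :
    (c • (p • (1 : Matrix ι ι ℝ) + q • (Hᵀ * H))).IsHermitian := by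
  simp [Matrix.IsHermitian, Matrix.conjTranspose_eq_transpose_of_trivial]

/-- Theorem 5.2(i) (sufficient decrease): if `β > max{β′, β″}`, there exist
`δᵢ ∈ (0,1)` with `δᵢMᵢ ⪰ Nᵢ` such that
`Ψ^k − Ψ^{k+1} ≥ Σᵢ (1−δᵢ)‖Δxᵢ^k‖²_{Mᵢ} ≥ 0` for every `k`. -/
theorem stmt17 (n : ℕ)
    (f : E4 n → E4 n → E3 n → E3 n → ℝ) (g : E4 n → E4 n → ℝ)
    (hf : ContDiff ℝ 1 fun p : (E4 n × E4 n) × E3 n × E3 n => f p.1.1 p.1.2 p.2.1 p.2.2)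
    (hg : ContDiff ℝ 1 fun p : E4 n × E4 n => g p.1 p.2)
    (Lf Lg : ℝ) (hLf : 0 < Lf) (hLg : 0 < Lg)
    (hfLip : ∀ a b : E4 n, ∀ c d : E3 n, ∀ a' b' : E4 n, ∀ c' d' : E3 n,
        Real.sqrt (‖grad1f f a b c d - grad1f f a' b' c' d'‖ ^ 2 +
            ‖grad2f f a b c d - grad2f f a' b' c' d'‖ ^ 2 +
            ‖grad3f f a b c d - grad3f f a' b' c' d'‖ ^ 2 +
            ‖grad4f f a b c d - grad4f f a' b' c' d'‖ ^ 2) ≤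
          Lf * Real.sqrt (‖a - a'‖ ^ 2 + ‖b - b'‖ ^ 2 + ‖c - c'‖ ^ 2 + ‖d - d'‖ ^ 2))
    (hgLip : ∀ a b a' b' : E4 n,
        Real.sqrt (‖grad1g g a b - grad1g g a' b'‖ ^ 2 +
            ‖grad2g g a b - grad2g g a' b'‖ ^ 2) ≤
          Lg * Real.sqrt (‖a - a'‖ ^ 2 + ‖b - b'‖ ^ 2))
    (hfconv1 : ∀ (b : E4 n) (c d : E3 n), ConvexOn ℝ Set.univ fun y => f y b c d)
    (hfconv2 : ∀ (a : E4 n) (c d : E3 n), ConvexOn ℝ Set.univ fun y => f a y c d)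
    (hfconv3 : ∀ (a b : E4 n) (d : E3 n), ConvexOn ℝ Set.univ fun y => f a b y d)
    (hfconv4 : ∀ (a b : E4 n) (c : E3 n), ConvexOn ℝ Set.univ fun y => f a b c y)
    (hgconv1 : ∀ b : E4 n, ConvexOn ℝ Set.univ fun y => g y b)
    (hgconv2 : ∀ a : E4 n, ConvexOn ℝ Set.univ fun y => g a y)
    (β τ : ℝ) (hβ : 0 < β) (hτ : τ ∈ Set.Ioo (0 : ℝ) 2)
    (H1 H2 : Matrix (Fin n × Fin 4) (Fin n × Fin 4) ℝ)
    (H3 H4 : Matrix (Fin n × Fin 3) (Fin n × Fin 3) ℝ)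
    (hH1 : H1.PosDef) (hH2 : H2.PosDef) (hH3 : H3.PosDef) (hH4 : H4.PosDef)
    (x1 x2 : ℕ → E4 n) (x3 x4 : ℕ → E3 n)
    (l1 : ℕ → E4 n) (l2 : ℕ → E3 n)
    (hbdd : ∃ R : ℝ, ∀ k, ‖x1 k‖ ≤ R ∧ ‖x2 k‖ ≤ R ∧ ‖x3 k‖ ≤ R ∧ ‖x4 k‖ ≤ R ∧
        ‖l1 k‖ ≤ R ∧ ‖l2 k‖ ≤ R)
    (hx1M : ∀ k, x1 k ∈ Msph n)
    (hmin1 : ∀ k, ∀ y ∈ Msph n,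
        augL f g β (x1 (k + 1)) (x2 k) (x3 k) (x4 k) (l1 k) (l2 k) +
            1 / 2 * qf H1 (x1 (k + 1) - x1 k) ≤
          augL f g β y (x2 k) (x3 k) (x4 k) (l1 k) (l2 k) + 1 / 2 * qf H1 (y - x1 k))
    (hmin2 : ∀ k, ∀ y : E4 n,
        augL f g β (x1 (k + 1)) (x2 (k + 1)) (x3 k) (x4 k) (l1 k) (l2 k) +
            1 / 2 * qf H2 (x2 (k + 1) - x2 k) ≤
          augL f g β (x1 (k + 1)) y (x3 k) (x4 k) (l1 k) (l2 k) + 1 / 2 * qf H2 (y - x2 k))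
    (hmin3 : ∀ k, ∀ y : E3 n,
        augL f g β (x1 (k + 1)) (x2 (k + 1)) (x3 (k + 1)) (x4 k) (l1 k) (l2 k) +
            1 / 2 * qf H3 (x3 (k + 1) - x3 k) ≤
          augL f g β (x1 (k + 1)) (x2 (k + 1)) y (x4 k) (l1 k) (l2 k) +
            1 / 2 * qf H3 (y - x3 k))
    (hmin4 : ∀ k, ∀ y : E3 n,
        augL f g β (x1 (k + 1)) (x2 (k + 1)) (x3 (k + 1)) (x4 (k + 1)) (l1 k) (l2 k) +
            1 / 2 * qf H4 (x4 (k + 1) - x4 k) ≤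
          augL f g β (x1 (k + 1)) (x2 (k + 1)) (x3 (k + 1)) y (l1 k) (l2 k) +
            1 / 2 * qf H4 (y - x4 k))
    (hdual1 : ∀ k, l1 (k + 1) = l1 k - (τ * β) • (x1 (k + 1) - x2 (k + 1)))
    (hdual2 : ∀ k, l2 (k + 1) = l2 k - (τ * β) • (x3 (k + 1) - x4 (k + 1)))
    (α1 α2 : ℝ)
    (hα1 : α1 = |1 - τ| / (1 - |1 - τ|))
    (hα2 : α2 = τ / (1 - |1 - τ|) ^ 2)
    (Lg2 : ℝ) (hLg2 : 0 < Lg2)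
    (hg2Lip : ∀ a b b' : E4 n, ‖grad2g g a b - grad2g g a b'‖ ≤ Lg2 * ‖b - b'‖)
    (fstar gstar : ℝ)
    (hfstar : IsGLB {r : ℝ | ∃ y1 ∈ Msph n, ∃ (y2 : E4 n) (y3 y4 : E3 n),
        r = f y1 y2 y3 y4} fstar)
    (hgstar : IsGLB {r : ℝ | ∃ y1 ∈ Msph n, ∃ y2 : E4 n, r = g y1 y2} gstar)
    (k1lo k2lo k2hi k3lo k4lo k4hi : ℝ)
    (hk1lo : IsLeast {μ : ℝ | ∃ v : (Fin n × Fin 4) → ℝ, v ≠ 0 ∧ H1 *ᵥ v = μ • v} k1lo)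
    (hk2lo : IsLeast {μ : ℝ | ∃ v : (Fin n × Fin 4) → ℝ, v ≠ 0 ∧ H2 *ᵥ v = μ • v} k2lo)
    (hk2hi : IsGreatest {μ : ℝ | ∃ v : (Fin n × Fin 4) → ℝ, v ≠ 0 ∧ H2 *ᵥ v = μ • v} k2hi)
    (hk3lo : IsLeast {μ : ℝ | ∃ v : (Fin n × Fin 3) → ℝ, v ≠ 0 ∧ H3 *ᵥ v = μ • v} k3lo)
    (hk4lo : IsLeast {μ : ℝ | ∃ v : (Fin n × Fin 3) → ℝ, v ≠ 0 ∧ H4 *ᵥ v = μ • v} k4lo)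
    (hk4hi : IsGreatest {μ : ℝ | ∃ v : (Fin n × Fin 3) → ℝ, v ≠ 0 ∧ H4 *ᵥ v = μ • v} k4hi)
    (βone : ℝ)
    (hβone : βone = max (2 * (Lf + Lg2)) (max (2 * α2 / k1lo * (7 * Lf ^ 2 + 4 * Lg ^ 2))
        (max (α2 / k2lo * (7 * Lf ^ 2 + 4 * Lg ^ 2) + (4 * α2 + 2) * k2hi ^ 2 / k2lo)
          (max ((3 * α2 + 2) / k3lo * Lf ^ 2)
            ((3 * α2 + 2) / k4lo * Lf ^ 2 + (3 * α2 + 1) * k4hi ^ 2 / k4lo)))))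
    (βtwo : ℝ)
    (hβtwo : βtwo = max (2 * α2 / k1lo * (7 * Lf ^ 2 + 4 * Lg ^ 2))
        (max (α2 / k2lo * (7 * Lf ^ 2 + 4 * Lg ^ 2 + 8 * k2hi ^ 2))
          (max (7 * α2 * Lf ^ 2 / k3lo) (α2 / k4lo * (7 * Lf ^ 2 + 6 * k4hi ^ 2)))))
    (hβgt : β > max βone βtwo)
    (M1 M2 N2 : Matrix (Fin n × Fin 4) (Fin n × Fin 4) ℝ)
    (M3 M4 N3 N4 : Matrix (Fin n × Fin 3) (Fin n × Fin 3) ℝ)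
    (hM1 : M1 = (1 / 2 : ℝ) • H1 - (α2 / β * (7 * Lf ^ 2 + 4 * Lg ^ 2)) • 1)
    (hM2 : M2 = H2 - (α2 / β) • ((7 * Lf ^ 2 + 4 * Lg ^ 2) • 1 + (4 : ℝ) • (H2ᵀ * H2)))
    (hM3 : M3 = H3 - (3 * α2 / β * Lf ^ 2) • 1)
    (hM4 : M4 = H4 - (α2 / β) • ((3 * Lf ^ 2) • 1 + (3 : ℝ) • (H4ᵀ * H4)))
    (hN2 : N2 = (4 * α2 / β) • (H2ᵀ * H2))
    (hN3 : N3 = (4 * α2 / β * Lf ^ 2) • 1)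
    (hN4 : N4 = (α2 / β) • ((4 * Lf ^ 2) • 1 + (3 : ℝ) • (H4ᵀ * H4)))
    :
    ∃ δ1 δ2 δ3 δ4 : ℝ,
      δ1 ∈ Set.Ioo (0 : ℝ) 1 ∧ δ2 ∈ Set.Ioo (0 : ℝ) 1 ∧
      δ3 ∈ Set.Ioo (0 : ℝ) 1 ∧ δ4 ∈ Set.Ioo (0 : ℝ) 1 ∧
      (δ1 • M1 - (0 : Matrix (Fin n × Fin 4) (Fin n × Fin 4) ℝ)).PosSemidef ∧
      (δ2 • M2 - N2).PosSemidef ∧ (δ3 • M3 - N3).PosSemidef ∧ (δ4 • M4 - N4).PosSemidef ∧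
      ∀ k, 1 ≤ k →
        ((1 - δ1) * qf M1 (x1 k - x1 (k - 1)) + (1 - δ2) * qf M2 (x2 k - x2 (k - 1)) +
            (1 - δ3) * qf M3 (x3 k - x3 (k - 1)) + (1 - δ4) * qf M4 (x4 k - x4 (k - 1)) ≤
          (augL f g β (x1 k) (x2 k) (x3 k) (x4 k) (l1 k) (l2 k) +
              α1 / (τ * β) * (‖l1 k - l1 (k - 1)‖ ^ 2 + ‖l2 k - l2 (k - 1)‖ ^ 2) +
              (qf M1 (x1 k - x1 (k - 1)) + qf M2 (x2 k - x2 (k - 1)) +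
                qf M3 (x3 k - x3 (k - 1)) + qf M4 (x4 k - x4 (k - 1)))) -
            (augL f g β (x1 (k + 1)) (x2 (k + 1)) (x3 (k + 1)) (x4 (k + 1))
                (l1 (k + 1)) (l2 (k + 1)) +
              α1 / (τ * β) * (‖l1 (k + 1) - l1 k‖ ^ 2 + ‖l2 (k + 1) - l2 k‖ ^ 2) +
              (qf M1 (x1 (k + 1) - x1 k) + qf M2 (x2 (k + 1) - x2 k) +
                qf M3 (x3 (k + 1) - x3 k) + qf M4 (x4 (k + 1) - x4 k)))) ∧
          0 ≤ (1 - δ1) * qf M1 (x1 k - x1 (k - 1)) + (1 - δ2) * qf M2 (x2 k - x2 (k - 1)) +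
            (1 - δ3) * qf M3 (x3 k - x3 (k - 1)) + (1 - δ4) * qf M4 (x4 k - x4 (k - 1)) := by
  have hτ0 := hτ.1
  have hs : |1 - τ| < 1 := abs_lt.2 ⟨by linarith [hτ.2], by linarith⟩
  have hα2pos : 0 < α2 := by
    have : 0 < 1 - |1 - τ| := by linarith
    rw [hα2]
    positivity
  have hc0 : 0 < α2 / β := by positivity
  have eigen_ge {ι : Type} [Fintype ι] [DecidableEq ι] {H : Matrix ι ι ℝ} (hH : H.PosDef) {κ : ℝ}
      (hκ : IsLeast {μ : ℝ | ∃ v : ι → ℝ, v ≠ 0 ∧ H *ᵥ v = μ • v} κ) :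
      0 < κ ∧ ∀ v, κ * ‖v‖ ^ 2 ≤ qf H v := by
    obtain ⟨⟨w, hw, hHw⟩, hlb⟩ := hκ
    exact ⟨eigenvalue_pos hH hw hHw,
      le_qf_of_forall_eigenvalue_ge hH.isHermitian fun μ v hv h => hlb ⟨v, hv, h⟩⟩
  obtain ⟨hk1, hq1⟩ := eigen_ge hH1 hk1lo
  obtain ⟨hk2, hq2⟩ := eigen_ge hH2 hk2lo
  obtain ⟨hk3, hq3⟩ := eigen_ge hH3 hk3lo
  obtain ⟨hk4, hq4⟩ := eigen_ge hH4 hk4lo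
  have hn2 := norm_toEuclideanLin_sq_le hH2 fun μ v hv h => hk2hi.2 ⟨v, hv, h⟩
  have hn4 := norm_toEuclideanLin_sq_le hH4 fun μ v hv h => hk4hi.2 ⟨v, hv, h⟩
  have hβ2 := (le_max_right βone βtwo).trans_lt hβgt
  rw [hβtwo, max_lt_iff, max_lt_iff, max_lt_iff] at hβ2
  obtain ⟨hb1, hb2, hb3, hb4⟩ := hβ2
  have hε1 : 0 < 1 / 2 * k1lo - α2 / β * (7 * Lf ^ 2 + 4 * Lg ^ 2) := by
    rw [div_mul_eq_mul_div, div_lt_iff₀ hk1] at hb1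
    rw [sub_pos, div_mul_eq_mul_div, div_lt_iff₀ hβ]
    linarith
  have hε2 : 0 < k2lo - α2 / β * (7 * Lf ^ 2 + 4 * Lg ^ 2 + 8 * k2hi ^ 2) := by
    rw [div_mul_eq_mul_div, div_lt_iff₀ hk2] at hb2
    rw [sub_pos, div_mul_eq_mul_div, div_lt_iff₀ hβ]
    linarith
  have hε3 : 0 < k3lo - α2 / β * (7 * Lf ^ 2) := by
    rw [div_lt_iff₀ hk3] at hb3
    rw [sub_pos, div_mul_eq_mul_div, div_lt_iff₀ hβ]
    linarith
  have hε4 : 0 < k4lo - α2 / β * (7 * Lf ^ 2 + 6 * k4hi ^ 2) := by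
    rw [div_mul_eq_mul_div, div_lt_iff₀ hk4] at hb4
    rw [sub_pos, div_mul_eq_mul_div, div_lt_iff₀ hβ]
    linarith
  have qM1 : ∀ v, qf M1 v = 1 / 2 * qf H1 v - α2 / β * (7 * Lf ^ 2 + 4 * Lg ^ 2) * ‖v‖ ^ 2 := by
    intro v
    rw [hM1, qf_sub, qf_smul, qf_smul, qf_one]
  have qM2 : ∀ v, qf M2 v = qf H2 v - α2 / β * ((7 * Lf ^ 2 + 4 * Lg ^ 2) * ‖v‖ ^ 2 +
      4 * ‖Matrix.toEuclideanLin H2 v‖ ^ 2) := by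
    intro v
    rw [hM2, qf_sub, qf_smul, qf_add, qf_smul, qf_smul, qf_one, qf_transpose_mul_self]
  have qM3 : ∀ v, qf M3 v = qf H3 v - α2 / β * (3 * Lf ^ 2 * ‖v‖ ^ 2) := by
    intro v
    rw [hM3, qf_sub, qf_smul, qf_one]
    ring
  have qM4 : ∀ v, qf M4 v = qf H4 v - α2 / β * (3 * Lf ^ 2 * ‖v‖ ^ 2 +
      3 * ‖Matrix.toEuclideanLin H4 v‖ ^ 2) := by
    intro v
    rw [hM4, qf_sub, qf_smul, qf_add, qf_smul, qf_smul, qf_one, qf_transpose_mul_self]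
  have qN1 : ∀ v, qf (0 : Matrix (Fin n × Fin 4) (Fin n × Fin 4) ℝ) v = 0 := by
    intro v
    simp [qf]
  have qN2 : ∀ v, qf N2 v = α2 / β * (4 * ‖Matrix.toEuclideanLin H2 v‖ ^ 2) := by
    intro v
    rw [hN2, qf_smul, qf_transpose_mul_self]
    ring
  have qN3 : ∀ v, qf N3 v = α2 / β * (4 * Lf ^ 2 * ‖v‖ ^ 2) := by
    intro v
    rw [hN3, qf_smul, qf_one]
    ring
  have qN4 : ∀ v, qf N4 v = α2 / β * (4 * Lf ^ 2 * ‖v‖ ^ 2 +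
      3 * ‖Matrix.toEuclideanLin H4 v‖ ^ 2) := by
    intro v
    rw [hN4, qf_smul, qf_add, qf_smul, qf_smul, qf_one, qf_transpose_mul_self]
  have hermScalar {ι : Type} [Fintype ι] [DecidableEq ι] (c : ℝ) :
      (c • (1 : Matrix ι ι ℝ)).IsHermitian := by
    simp [Matrix.IsHermitian]
  obtain ⟨δ1, hδ1, psd1, -, hnn1⟩ := exists_shrink (M := M1) (N := 0)
    (by rw [hM1]; exact (hH1.isHermitian.smul (IsSelfAdjoint.all _)).sub (hermScalar _))
    Matrix.isHermitian_zero (fun v => (qN1 v).ge) hε1 (fun v => by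
      rw [qM1, qN1]
      linarith [hq1 v])
  obtain ⟨δ2, hδ2, psd2, hle2, hnn2⟩ := exists_shrink (M := M2) (N := N2)
    (by rw [hM2]; exact hH2.isHermitian.sub (isHermitian_smul_add_smul_transpose_mul _ _ _ _))
    (by simpa [hN2] using isHermitian_smul_add_smul_transpose_mul (4 * α2 / β) 0 1 H2)
    (fun v => by rw [qN2]; positivity) hε2 (fun v => by
      rw [qM2, qN2]
      linarith [hq2 v, mul_le_mul_of_nonneg_left (hn2 v) hc0.le])
  obtain ⟨δ3, hδ3, psd3, hle3, hnn3⟩ := exists_shrink (M := M3) (N := N3)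
    (by rw [hM3]; exact hH3.isHermitian.sub (hermScalar _)) (by rw [hN3]; exact hermScalar _)
    (fun v => by rw [qN3]; positivity) hε3 (fun v => by
      rw [qM3, qN3]
      linarith [hq3 v])
  obtain ⟨δ4, hδ4, psd4, hle4, hnn4⟩ := exists_shrink (M := M4) (N := N4)
    (by rw [hM4]; exact hH4.isHermitian.sub (isHermitian_smul_add_smul_transpose_mul _ _ _ _))
    (by rw [hN4]; exact isHermitian_smul_add_smul_transpose_mul _ _ _ _)
    (fun v => by rw [qN4]; positivity) hε4 (fun v => by
      rw [qM4, qN4]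
      linarith [hq4 v, mul_le_mul_of_nonneg_left (hn4 v) hc0.le])
  refine ⟨δ1, δ2, δ3, δ4, hδ1, hδ2, hδ3, hδ4, psd1, psd2, psd3, psd4, ?_⟩
  have hfd := hf.differentiable one_ne_zero
  have hgd := hg.differentiable one_ne_zero
  have opt2 : ∀ k, l1 k - β • (x1 (k + 1) - x2 (k + 1)) =
      -(grad2f f (x1 (k + 1)) (x2 (k + 1)) (x3 k) (x4 k) + grad2g g (x1 (k + 1)) (x2 (k + 1)) +
        Matrix.toEuclideanLin H2 (x2 (k + 1) - x2 k)) := by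
    intro k
    have df : DifferentiableAt ℝ (fun y => f (x1 (k + 1)) y (x3 k) (x4 k)) (x2 (k + 1)) :=
      (hfd.comp (f := fun y => ((x1 (k + 1), y), x3 k, x4 k)) (by fun_prop)).differentiableAt
    have dg : DifferentiableAt ℝ (fun y => g (x1 (k + 1)) y) (x2 (k + 1)) :=
      (hgd.comp (f := fun y => (x1 (k + 1), y)) (by fun_prop)).differentiableAt
    have hG : HasGradientAt (fun y => f (x1 (k + 1)) y (x3 k) (x4 k) + g (x1 (k + 1)) y)
        (grad2f f (x1 (k + 1)) (x2 (k + 1)) (x3 k) (x4 k) +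
          grad2g g (x1 (k + 1)) (x2 (k + 1))) (x2 (k + 1)) := by
      rw [hasGradientAt_iff_hasFDerivAt, map_add]
      exact df.hasGradientAt.hasFDerivAt.add dg.hasGradientAt.hasFDerivAt
    refine proximal_optimality hG β hH2.isHermitian _ _ _ fun y => ?_
    have := hmin2 k y
    simp only [augL] at this
    linarith
  have opt4 : ∀ k, l2 k - β • (x3 (k + 1) - x4 (k + 1)) =
      -(grad4f f (x1 (k + 1)) (x2 (k + 1)) (x3 (k + 1)) (x4 (k + 1)) +
        Matrix.toEuclideanLin H4 (x4 (k + 1) - x4 k)) := by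
    intro k
    have df : DifferentiableAt ℝ (fun y => f (x1 (k + 1)) (x2 (k + 1)) (x3 (k + 1)) y)
        (x4 (k + 1)) :=
      (hfd.comp (f := fun y => ((x1 (k + 1), x2 (k + 1)), x3 (k + 1), y))
        (by fun_prop)).differentiableAt
    refine proximal_optimality df.hasGradientAt β hH4.isHermitian _ _ _ fun y => ?_
    have := hmin4 k y
    simp only [augL] at this
    linarith
  intro k hk
  obtain ⟨m, rfl⟩ : ∃ m, k = m + 1 := ⟨k - 1, by omega⟩
  simp only [Nat.add_sub_cancel]
  refine ⟨?_, add_nonneg (add_nonneg (add_nonneg (hnn1 _) (hnn2 _)) (hnn3 _)) (hnn4 _)⟩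
  have hsweep := augL_sweep_descent hfconv2 hfconv3 hfconv4 hgconv2 hβ
    (by simpa [qf] using hmin1 (m + 1) _ (hx1M (m + 1)))
    (hmin2 (m + 1)) (hmin3 (m + 1)) (hmin4 (m + 1))
  have hdual := augL_dual_step f g β (mul_pos hτ0 hβ).ne' (x1 (m + 1 + 1)) (x2 (m + 1 + 1))
    (x3 (m + 1 + 1)) (x4 (m + 1 + 1)) (hdual1 (m + 1)) (hdual2 (m + 1))
  have hl1 := multiplier_increment_le hτ hβ (hdual1 m) (hdual1 (m + 1))
  have hl2 := multiplier_increment_le hτ hβ (hdual2 m) (hdual2 (m + 1))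
  rw [opt2, opt2, ← hα1, ← hα2] at hl1
  rw [opt4, opt4, ← hα1, ← hα2] at hl2
  have hw1 := mul_le_mul_of_nonneg_left (residual_increment_sq_le hfLip hgLip
    (x1 (m + 1 + 1)) (x2 (m + 1 + 1)) (x1 (m + 1)) (x2 (m + 1))
    (Matrix.toEuclideanLin H2 (x2 (m + 1 + 1) - x2 (m + 1)))
    (Matrix.toEuclideanLin H2 (x2 (m + 1) - x2 m))
    (x3 (m + 1)) (x4 (m + 1)) (x3 m) (x4 m)) hc0.le
  have hw2 := mul_le_mul_of_nonneg_left (residual_increment_sq_le' hfLip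
    (x1 (m + 1 + 1)) (x2 (m + 1 + 1)) (x1 (m + 1)) (x2 (m + 1))
    (x3 (m + 1 + 1)) (x4 (m + 1 + 1)) (x3 (m + 1)) (x4 (m + 1))
    (Matrix.toEuclideanLin H4 (x4 (m + 1 + 1) - x4 (m + 1)))
    (Matrix.toEuclideanLin H4 (x4 (m + 1) - x4 m))) hc0.le
  have hd1 := hnn1 (x1 (m + 1) - x1 m)
  have hd1' : 0 ≤ δ1 * qf M1 (x1 (m + 1) - x1 m) :=
    mul_nonneg hδ1.1.le (nonneg_of_mul_nonneg_right hd1 (by linarith [hδ1.2]))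
  have hd2 := hle2 (x2 (m + 1) - x2 m)
  have hd3 := hle3 (x3 (m + 1) - x3 m)
  have hd4 := hle4 (x4 (m + 1) - x4 m)
  rw [qN2] at hd2
  rw [qN3] at hd3
  rw [qN4] at hd4
  have e1 := qM1 (x1 (m + 1 + 1) - x1 (m + 1))
  have e2 := qM2 (x2 (m + 1 + 1) - x2 (m + 1))
  have e3 := qM3 (x3 (m + 1 + 1) - x3 (m + 1))
  have e4 := qM4 (x4 (m + 1 + 1) - x4 (m + 1))
  linarith

end
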